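/- Let m, k, N be positive integers and let E = {v_1,…,v_N} ⊂ R^m be a generic set of nonzero vectors. Suppose the indices (1/p_j, λ_j)_{j=1}^N satisfy 1/p_j ∈ (0,1), λ_j ≥ 0 for every j, together with (Scaling) Σ_{j=1}^N (1/p_j + λ_j/k) = m, (v1) Σ_{v_j∉V} (1/p_j + λ_j/k) > m − dim(V) for every nonzero proper linear subspace V of R^m, and (I) Σ_{j=1}^N 1/p_j ≥ 1. Then there is a finite constant C such that Λ(f_1,…,f_N) ≤ C Π_{j=1}^N ‖f_j‖_{L^{p_j}_{λ_j}(R^k)} for all nonnegative measurable f_1,…,f_N on R^k. -/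

import Mathlib

open MeasureTheory ENNReal
open scoped Classical

/-- The dot product `v · x ∈ ℝᵏ` for `v ∈ ℝᵐ` and `x ∈ (ℝᵏ)ᵐ`. -/
noncomputable def dotv {m k : ℕ} (v : Fin m → ℝ)
    (x : Fin m → EuclideanSpace ℝ (Fin k)) : EuclideanSpace ℝ (Fin k) :=
  ∑ i, v i • x i

/-- The Brascamp–Lieb form `Λ(f₁,…,f_N) = ∫ ∏ f_j(v_j · x) dx`. -/
noncomputable def BLform {m k N : ℕ} (v : Fin N → Fin m → ℝ)
    (f : Fin N → EuclideanSpace ℝ (Fin k) → ℝ≥0∞) : ℝ≥0∞ :=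
  ∫⁻ x : Fin m → EuclideanSpace ℝ (Fin k), ∏ j, f j (dotv (v j) x)

/-- The weighted norm `‖f‖_{L^p_α} = ‖ |·|^α f ‖_{L^p}`. -/
noncomputable def wnorm {k : ℕ} (p α : ℝ)
    (f : EuclideanSpace ℝ (Fin k) → ℝ≥0∞) : ℝ≥0∞ :=
  (∫⁻ y : EuclideanSpace ℝ (Fin k), ((‖y‖₊ : ℝ≥0∞) ^ α * f y) ^ p) ^ (1 / p)

/-- A family of vectors in `ℝᵐ` is generic if every subfamily of cardinality `m`
is a basis of `ℝᵐ`. -/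
def IsGeneric {m N : ℕ} (v : Fin N → Fin m → ℝ) : Prop :=
  ∀ s : Finset (Fin N), s.card = m →
    LinearIndependent ℝ (fun i : s => v i.1) ∧
      Submodule.span ℝ (v '' ↑s) = ⊤

theorem ENNReal.rpow_eq_rpow_sub_one_mul_self (x : ℝ≥0∞) {s : ℝ} (hs : 1 ≤ s) :
    x ^ s = x ^ (s - 1) * x := by
  conv_rhs => enter [2]; rw [← ENNReal.rpow_one x]
  rw [← ENNReal.rpow_add_of_nonneg _ _ (by linarith) zero_le_one, sub_add_cancel]

/-- Distributivity of a finite product over infinite sums in `ℝ≥0∞`. -/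
theorem ENNReal.prod_tsum_eq_tsum_prod {ι : Type*} :
    ∀ {N : ℕ} (F : Fin N → ι → ℝ≥0∞),
      ∏ j, ∑' n, F j n = ∑' n : Fin N → ι, ∏ j, F j (n j)
  | 0, F => by simp [tsum_fintype]
  | N + 1, F => by
    rw [Fin.prod_univ_succ, ENNReal.prod_tsum_eq_tsum_prod, ← ENNReal.tsum_mul_right,
      ← (Fin.consEquiv fun _ : Fin (N + 1) => ι).tsum_eq, ENNReal.tsum_prod']
    refine tsum_congr fun a => ?_
    rw [← ENNReal.tsum_mul_left]
    exact tsum_congr fun b => by simp [Fin.prod_univ_succ, Fin.consEquiv]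

/-- Tonelli's theorem for tensor products over `Fin m`. -/
theorem MeasureTheory.lintegral_pi_prod_eq_prod {E : Type*} [MeasureSpace E]
    [SigmaFinite (volume : Measure E)] :
    ∀ {m : ℕ} (g : Fin m → E → ℝ≥0∞), (∀ i, Measurable (g i)) →
      ∫⁻ x : Fin m → E, ∏ i, g i (x i) = ∏ i, ∫⁻ y, g i y
  | 0, g, _ => by simp [volume_pi]
  | m + 1, g, hg => by
    have e := (volume_preserving_piFinSuccAbove (fun _ : Fin (m + 1) => E) 0).symm
    have hmeas : Measurable fun x : Fin (m + 1) → E => ∏ i, g i (x i) :=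
      Finset.measurable_fun_prod _ fun i _ => (hg i).comp (measurable_pi_apply i)
    have htail : Measurable fun z : Fin m → E => ∏ i, g i.succ (z i) :=
      Finset.measurable_fun_prod _ fun i _ => (hg i.succ).comp (measurable_pi_apply i)
    rw [← e.lintegral_comp hmeas, Fin.prod_univ_succ,
      ← lintegral_pi_prod_eq_prod (fun i => g i.succ) fun i => hg _,
      ← lintegral_prod_mul (hg 0).aemeasurable htail.aemeasurable, Measure.volume_eq_prod]
    refine lintegral_congr fun z => ?_
    simp [Fin.prod_univ_succ, MeasurableEquiv.piFinSuccAbove, Fin.insertNthEquiv]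

/-- For `1 ≤ σ`, the sum of `σ`-th powers is at most the `σ`-th power of the sum. -/
theorem ENNReal.tsum_rpow_le_rpow_tsum {ι : Type*} (x : ι → ℝ≥0∞) {σ : ℝ} (hσ : 1 ≤ σ) :
    ∑' n, x n ^ σ ≤ (∑' n, x n) ^ σ := by
  rw [ENNReal.rpow_eq_rpow_sub_one_mul_self (∑' n, x n) hσ, ← ENNReal.tsum_mul_left]
  refine ENNReal.tsum_le_tsum fun n => ?_
  rw [ENNReal.rpow_eq_rpow_sub_one_mul_self _ hσ]
  gcongr
  exact ENNReal.le_tsum n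

/-- Hölder's inequality for sums when the reciprocals of the exponents add up to at least one. -/
theorem ENNReal.tsum_prod_le_prod_Lp {N : ℕ} {p : Fin N → ℝ} (hp : ∀ j, 0 < p j)
    (hI : 1 ≤ ∑ j, 1 / p j) (B : Fin N → ℤ → ℝ≥0∞) :
    ∑' τ, ∏ j, B j τ ≤ ∏ j, (∑' τ, B j τ ^ p j) ^ (1 / p j) := by
  set σ := ∑ j, 1 / p j
  have hσ : 0 < σ := by linarith
  have holder := ENNReal.lintegral_prod_norm_pow_le (μ := (Measure.count : Measure ℤ))
    Finset.univ (f := fun j τ => B j τ ^ (p j * σ)) (fun j _ => by fun_prop)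
    (p := fun j => 1 / (p j * σ))
    (by
      have : ∀ j, 1 / (p j * σ) = (1 / p j) / σ := fun j => by rw [div_div]
      simp_rw [this]
      rw [← Finset.sum_div]
      exact div_self hσ.ne')
    (fun j _ => by have := hp j; positivity)
  simp_rw [lintegral_count] at holder
  calc ∑' τ, ∏ j, B j τ = ∑' τ, ∏ j, (B j τ ^ (p j * σ)) ^ (1 / (p j * σ)) := by
        refine tsum_congr fun τ => Finset.prod_congr rfl fun j _ => ?_
        have := hp j
        rw [← ENNReal.rpow_mul, mul_one_div_cancel (by positivity), ENNReal.rpow_one]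
    _ ≤ _ := holder
    _ ≤ _ := by
        refine Finset.prod_le_prod' fun j _ => ?_
        have hj := hp j
        calc (∑' τ, B j τ ^ (p j * σ)) ^ (1 / (p j * σ))
            ≤ ((∑' τ, B j τ ^ p j) ^ σ) ^ (1 / (p j * σ)) := by
              gcongr
              simp_rw [ENNReal.rpow_mul]
              exact ENNReal.tsum_rpow_le_rpow_tsum _ hI
          _ = _ := by
              rw [← ENNReal.rpow_mul]
              congr 1
              field_simp

/-- Weighted Hölder inequality for infinite sums. -/
theorem ENNReal.tsum_mul_rpow_le {ι : Type*} {p : ℝ} (hp : 1 ≤ p) (w f : ι → ℝ≥0∞) :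
    (∑' i, w i * f i) ^ p ≤ (∑' i, w i) ^ (p - 1) * ∑' i, w i * f i ^ p := by
  have hp0 : 0 < p := by linarith
  rw [← ENNReal.le_rpow_inv_iff hp0, ENNReal.tsum_eq_iSup_sum]
  refine iSup_le fun s => (ENNReal.inner_le_weight_mul_Lp_of_nonneg s hp w f).trans ?_
  rw [ENNReal.mul_rpow_of_nonneg _ _ (by positivity), ← ENNReal.rpow_mul]
  have hexp : (p - 1) * p⁻¹ = 1 - p⁻¹ := by field_simp
  rw [hexp]
  have : 0 ≤ 1 - p⁻¹ := sub_nonneg.2 (inv_le_one_of_one_le₀ hp)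
  gcongr <;> exact ENNReal.sum_le_tsum s

/-- Young's convolution inequality on `ℤ`. -/
theorem ENNReal.tsum_convolution_rpow_le {p : ℝ} (hp : 1 ≤ p) (b φ : ℤ → ℝ≥0∞) :
    (∑' τ, (∑' n, b n * φ (n - τ)) ^ p) ^ (1 / p) ≤
      (∑' n, φ n) * (∑' n, b n ^ p) ^ (1 / p) := by
  have hp0 : 0 < p := by linarith
  have hsub : ∀ n : ℤ, ∑' τ, φ (n - τ) = ∑' l, φ l := fun n => (Equiv.subLeft n).tsum_eq φ
  have hsub' : ∀ τ : ℤ, ∑' n, φ (n - τ) = ∑' l, φ l := fun τ => (Equiv.subRight τ).tsum_eq φ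
  have key : ∑' τ, (∑' n, b n * φ (n - τ)) ^ p ≤ (∑' l, φ l) ^ p * ∑' n, b n ^ p := by
    calc ∑' τ, (∑' n, b n * φ (n - τ)) ^ p
        ≤ ∑' τ, (∑' l, φ l) ^ (p - 1) * ∑' n, φ (n - τ) * b n ^ p := by
          refine ENNReal.tsum_le_tsum fun τ => ?_
          rw [← hsub' τ]
          simp_rw [mul_comm (b _)]
          exact ENNReal.tsum_mul_rpow_le hp _ _
      _ = (∑' l, φ l) ^ (p - 1) * ((∑' l, φ l) * ∑' n, b n ^ p) := by
          rw [ENNReal.tsum_mul_left, ENNReal.tsum_comm]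
          simp_rw [ENNReal.tsum_mul_right, hsub, ENNReal.tsum_mul_left]
      _ = _ := by
          rw [← mul_assoc, ← ENNReal.rpow_eq_rpow_sub_one_mul_self _ hp]
  calc _ ≤ ((∑' l, φ l) ^ p * ∑' n, b n ^ p) ^ (1 / p) := by gcongr
    _ = _ := by
      rw [ENNReal.mul_rpow_of_nonneg _ _ (by positivity), ← ENNReal.rpow_mul,
        mul_one_div_cancel hp0.ne', ENNReal.rpow_one]

/-- A set of given measure has the least integral of `‖y‖ ^ s`, up to a constant, when it is a
ball centred at the origin. -/
theorem exists_measure_rpow_le_mul_lintegral_norm_rpow {E : Type*} [NormedAddCommGroup E]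
    [NormedSpace ℝ E] [FiniteDimensional ℝ E] [Nontrivial E] [MeasurableSpace E] [BorelSpace E]
    (μ : Measure E) [μ.IsAddHaarMeasure] {s : ℝ} (hs : 0 ≤ s) :
    ∃ c : ℝ≥0∞, c ≠ ⊤ ∧ ∀ A : Set E, MeasurableSet A →
      μ A ^ (1 + s / Module.finrank ℝ E) ≤ c * ∫⁻ y in A, ‖y‖ₑ ^ s ∂μ := by
  set d := Module.finrank ℝ E with hd
  have hd0 : 0 < d := Module.finrank_pos
  have hd0' : (0 : ℝ) < d := by exact_mod_cast hd0
  set ω := μ (Metric.ball 0 1) with hω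
  have hω0 : ω ≠ 0 := (Metric.measure_ball_pos μ 0 one_pos).ne'
  have hωt : ω ≠ ⊤ := measure_ball_lt_top.ne
  have hsd : 0 ≤ s / d := by positivity
  have hc0 : 2 * (2 * ω) ^ (s / d) ≠ 0 := by simp [hω0, hsd]
  refine ⟨2 * (2 * ω) ^ (s / d), by finiteness, fun A hA => ?_⟩
  have tail : ∀ r : ℝ, 0 ≤ r →
      ENNReal.ofReal r ^ s * (μ A - μ (Metric.ball 0 r)) ≤ ∫⁻ y in A, ‖y‖ₑ ^ s ∂μ := by
    intro r hr
    calc ENNReal.ofReal r ^ s * (μ A - μ (Metric.ball 0 r))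
        ≤ ENNReal.ofReal r ^ s * μ (A \ Metric.ball 0 r) := by
          gcongr; exact le_measure_sdiff
      _ = ∫⁻ _ in A \ Metric.ball 0 r, ENNReal.ofReal r ^ s ∂μ := by
          rw [setLIntegral_const]
      _ ≤ ∫⁻ y in A \ Metric.ball 0 r, ‖y‖ₑ ^ s ∂μ := by
          refine setLIntegral_mono' (hA.diff measurableSet_ball) fun y hy => ?_
          have : r ≤ ‖y‖ := by simpa using hy.2
          rw [← ofReal_norm]
          gcongr
      _ ≤ _ := lintegral_mono_set Set.sdiff_subset
  rcases eq_or_ne (μ A) ⊤ with htop | htop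
  · have h1 := tail 1 zero_le_one
    rw [htop, ENNReal.top_sub (by exact hωt)] at h1
    simp only [ENNReal.ofReal_one, ENNReal.one_rpow, one_mul, top_le_iff] at h1
    rw [h1, ENNReal.mul_top hc0]
    exact le_top
  · set r : ℝ := ((μ A).toReal / (2 * ω.toReal)) ^ (1 / (d : ℝ)) with hr
    have hr0 : 0 ≤ r := by positivity
    have hω' : 0 < ω.toReal := ENNReal.toReal_pos hω0 hωt
    have hpow : r ^ d = (μ A).toReal / (2 * ω.toReal) := by
      rw [hr, ← Real.rpow_natCast, ← Real.rpow_mul (by positivity), one_div,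
        inv_mul_cancel₀ hd0'.ne', Real.rpow_one]
    have hball : μ (Metric.ball 0 r) = μ A / 2 := by
      rw [Measure.addHaar_ball μ 0 hr0, hpow, ← ENNReal.ofReal_toReal (a := μ (Metric.ball 0 1)) hωt,
        ← ENNReal.ofReal_mul (by positivity)]
      nth_rewrite 2 [← ENNReal.ofReal_toReal htop]
      rw [← ENNReal.ofReal_ofNat 2, ← ENNReal.ofReal_div_of_pos two_pos]
      congr 1
      change (μ A).toReal / (2 * ω.toReal) * ω.toReal = _
      field_simp
    have hA2 : μ A = 2 * ω * ENNReal.ofReal r ^ (d : ℝ) := by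
      have h2 : μ A = 2 * (μ A / 2) := (ENNReal.mul_div_cancel (by simp) (by simp)).symm
      rw [h2, ← hball, Measure.addHaar_ball μ 0 hr0, ENNReal.ofReal_pow hr0,
        ENNReal.rpow_natCast]
      ring
    have hA3 : μ A ^ (s / d) = (2 * ω) ^ (s / d) * ENNReal.ofReal r ^ s := by
      rw [hA2, ENNReal.mul_rpow_of_nonneg _ _ hsd, ← ENNReal.rpow_mul]
      congr 2
      field_simp
    have h1 := tail r hr0
    rw [hball, ENNReal.sub_half htop] at h1
    calc μ A ^ (1 + s / d) = μ A ^ (s / d) * μ A := by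
          rw [ENNReal.rpow_eq_rpow_sub_one_mul_self _ (by linarith), add_sub_cancel_left]
      _ = 2 * (2 * ω) ^ (s / d) * (ENNReal.ofReal r ^ s * (μ A / 2)) := by
          nth_rewrite 2 [← ENNReal.mul_div_cancel (a := 2) (b := μ A) (by simp) (by simp)]
          rw [hA3]; ring
      _ ≤ _ := by gcongr

theorem lintegral_Ioi_ite_ofReal_lt (c : ℝ≥0∞) :
    ∫⁻ t in Set.Ioi (0 : ℝ), (if ENNReal.ofReal t < c then 1 else 0) = c := by
  have hset : MeasurableSet {t : ℝ | ENNReal.ofReal t < c} :=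
    measurableSet_lt ENNReal.measurable_ofReal measurable_const
  have : ∫⁻ t in Set.Ioi (0 : ℝ), (if ENNReal.ofReal t < c then (1 : ℝ≥0∞) else 0) =
      volume ({t : ℝ | ENNReal.ofReal t < c} ∩ Set.Ioi 0) := by
    rw [← Measure.restrict_apply hset, ← lintegral_indicator_one hset]
    exact lintegral_congr fun t => by simp [Set.indicator_apply]
  rw [this]
  rcases eq_or_ne c ⊤ with rfl | hc
  · simp
  · have : {t : ℝ | ENNReal.ofReal t < c} ∩ Set.Ioi 0 = Set.Ioo 0 c.toReal := by
      ext t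
      simp only [Set.mem_inter_iff, Set.mem_ofPred_eq, Set.mem_Ioi, Set.mem_Ioo]
      constructor
      · rintro ⟨h1, h2⟩
        exact ⟨h2, (ENNReal.ofReal_lt_iff_lt_toReal h2.le hc).1 h1⟩
      · rintro ⟨h1, h2⟩
        exact ⟨(ENNReal.ofReal_lt_iff_lt_toReal h1.le hc).2 h2, h1⟩
    rw [this, Real.volume_Ioo, sub_zero, ENNReal.ofReal_toReal hc]

/-- The layer-cake lower bound for the weighted norm in terms of the distribution function. -/
theorem exists_lintegral_distribution_le {k : ℕ} (hk : 0 < k) {p lam : ℝ} (hp : 1 < p)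
    (hlam : 0 ≤ lam) :
    ∃ c : ℝ≥0∞, c ≠ ⊤ ∧ ∀ f : EuclideanSpace ℝ (Fin k) → ℝ≥0∞, Measurable f →
      ∫⁻ t in Set.Ioi (0 : ℝ), ENNReal.ofReal t ^ (p - 1) *
          volume {y | ENNReal.ofReal t < f y} ^ (1 + lam * p / k) ≤
        c * ∫⁻ y, ((‖y‖₊ : ℝ≥0∞) ^ lam * f y) ^ p := by
  have : Nonempty (Fin k) := ⟨⟨0, hk⟩⟩
  obtain ⟨c, hc, hbound⟩ := exists_measure_rpow_le_mul_lintegral_norm_rpow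
    (volume : Measure (EuclideanSpace ℝ (Fin k))) (s := lam * p) (by positivity)
  rw [finrank_euclideanSpace_fin] at hbound
  refine ⟨c, hc, fun f hf => ?_⟩
  have hset : MeasurableSet {z : ℝ × EuclideanSpace ℝ (Fin k) | ENNReal.ofReal z.1 < f z.2} :=
    measurableSet_lt (by fun_prop) (by fun_prop)
  have hI : Measurable fun z : ℝ × EuclideanSpace ℝ (Fin k) =>
      if ENNReal.ofReal z.1 < f z.2 then (1 : ℝ≥0∞) else 0 :=
    Measurable.ite hset measurable_const measurable_const
  calc ∫⁻ t in Set.Ioi (0 : ℝ), ENNReal.ofReal t ^ (p - 1) *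
          volume {y | ENNReal.ofReal t < f y} ^ (1 + lam * p / k)
      ≤ ∫⁻ t in Set.Ioi (0 : ℝ), c * ∫⁻ y, ‖y‖ₑ ^ (lam * p) * (ENNReal.ofReal t ^ (p - 1) *
          if ENNReal.ofReal t < f y then 1 else 0) := by
        refine lintegral_mono fun t => ?_
        have hlevel : MeasurableSet {y | ENNReal.ofReal t < f y} :=
          measurableSet_lt measurable_const hf
        refine (mul_le_mul_right (hbound _ hlevel) _).trans (le_of_eq ?_)
        rw [mul_left_comm, ← lintegral_indicator hlevel, ← lintegral_const_mul _ (by fun_prop)]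
        congr 1
        refine lintegral_congr fun y => ?_
        by_cases h : ENNReal.ofReal t < f y
        · simp [h, mul_comm]
        · simp [h]
    _ = c * ∫⁻ y, ‖y‖ₑ ^ (lam * p) * ∫⁻ t in Set.Ioi (0 : ℝ), (ENNReal.ofReal t ^ (p - 1) *
          if ENNReal.ofReal t < f y then 1 else 0) := by
        rw [lintegral_const_mul' _ _ hc, lintegral_lintegral_swap]
        · congr 1
          refine lintegral_congr fun y => ?_
          rw [lintegral_const_mul]
          exact (by fun_prop : Measurable fun t : ℝ => ENNReal.ofReal t ^ (p - 1)).mul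
            (hI.comp (measurable_id.prodMk measurable_const))
        · refine Measurable.aemeasurable ?_
          refine Measurable.mul (by fun_prop) (Measurable.mul (by fun_prop) hI)
    _ ≤ _ := by
        gcongr with y
        rw [ENNReal.mul_rpow_of_nonneg _ _ (by linarith), ← ENNReal.rpow_mul]
        change ‖y‖ₑ ^ (lam * p) * _ ≤ ‖y‖ₑ ^ (lam * p) * _
        gcongr
        rw [ENNReal.rpow_eq_rpow_sub_one_mul_self _ hp.le]
        conv_rhs => enter [2]; rw [← lintegral_Ioi_ite_ofReal_lt (f y)]
        have hIy : Measurable fun t : ℝ => if ENNReal.ofReal t < f y then (1 : ℝ≥0∞) else 0 :=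
          hI.comp (measurable_id.prodMk measurable_const)
        rw [← lintegral_const_mul _ hIy]
        refine lintegral_mono fun t => ?_
        by_cases h : ENNReal.ofReal t < f y
        · simp only [h, if_true, mul_one]
          gcongr
        · simp [h]

/-- Atomic decomposition of a function in a weighted Lebesgue space: the `n`-th piece is bounded
by `h n` and has integral at most `2 ^ (n + 1) * h n`. -/
theorem exists_atomic_decomposition {k : ℕ} (hk : 0 < k) {p lam : ℝ} (hp : 1 < p)
    (hlam : 0 ≤ lam) :
    ∃ c : ℝ≥0∞, c ≠ ⊤ ∧ ∀ f : EuclideanSpace ℝ (Fin k) → ℝ≥0∞, Measurable f →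
      wnorm p lam f ≠ ⊤ →
      ∃ (F : ℤ → EuclideanSpace ℝ (Fin k) → ℝ≥0∞) (h : ℤ → ℝ≥0∞),
        (∀ n, Measurable (F n)) ∧ (∀ᵐ y, f y ≤ ∑' n, F n y) ∧ (∀ n y, F n y ≤ h n) ∧
        (∀ n, ∫⁻ y, F n y ≤ 2 ^ ((n : ℝ) + 1) * h n) ∧
        (∑' n : ℤ, (2 ^ ((n : ℝ) * (1 / p + lam / k)) * h n) ^ p) ^ (1 / p) ≤
          c * wnorm p lam f := by
  have hp0 : 0 < p := by linarith
  have hk0 : (0 : ℝ) < k := by exact_mod_cast hk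
  obtain ⟨c₁, hc₁, hdist⟩ := exists_lintegral_distribution_le hk hp hlam
  obtain ⟨c₂, hc₂, hline⟩ := exists_measure_rpow_le_mul_lintegral_norm_rpow
    (volume : Measure ℝ) (s := p - 1) (by linarith)
  rw [Module.finrank_self, Nat.cast_one, div_one, add_sub_cancel] at hline
  refine ⟨(c₂ * c₁) ^ (1 / p), by finiteness, fun f hf hfin => ?_⟩
  have hset : MeasurableSet {z : ℝ × EuclideanSpace ℝ (Fin k) | ENNReal.ofReal z.1 < f z.2} :=
    measurableSet_lt (by fun_prop) (by fun_prop)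
  set I : ℝ → EuclideanSpace ℝ (Fin k) → ℝ≥0∞ :=
    fun t y => if ENNReal.ofReal t < f y then 1 else 0 with hIdef
  have hI : Measurable (Function.uncurry I) :=
    Measurable.ite hset measurable_const measurable_const
  set D : ℝ → ℝ≥0∞ := fun t => volume {y | ENNReal.ofReal t < f y} with hDdef
  have hDI : ∀ t, ∫⁻ y, I t y = D t := by
    intro t
    have hlevel : MeasurableSet {y | ENNReal.ofReal t < f y} :=
      measurableSet_lt measurable_const hf
    simp only [hDdef]
    rw [← lintegral_indicator_one hlevel]
    exact lintegral_congr fun y => by simp [hIdef, Set.indicator_apply]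
  have hD : Measurable D := measurable_measure_prodMk_left hset
  have hswap : ∀ T : Set ℝ, ∫⁻ y, ∫⁻ t in T, I t y = ∫⁻ t in T, D t := by
    intro T
    rw [← lintegral_lintegral_swap hI.aemeasurable]
    simp_rw [hDI]
  have hmeas : ∀ T : Set ℝ, Measurable fun y => ∫⁻ t in T, I t y :=
    fun T => hI.lintegral_prod_left'
  set T : ℤ → Set ℝ := fun n => Set.Ioi 0 ∩ D ⁻¹' Set.Ico (2 ^ n) (2 ^ (n + 1)) with hT
  have hTm : ∀ n, MeasurableSet (T n) := fun n => measurableSet_Ioi.inter (hD measurableSet_Ico)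
  have hTdisj : Pairwise (Function.onFun Disjoint T) := by
    intro n n' hnn
    rw [Function.onFun, Set.disjoint_left]
    rintro t ⟨-, h1, h2⟩ ⟨-, h3, h4⟩
    have hmono : ∀ a b : ℤ, (2 : ℝ≥0∞) ^ a < 2 ^ b → a < b := fun a b hab => by
      by_contra hle
      exact absurd hab (not_lt.2 (ENNReal.zpow_le_of_le one_le_two (not_lt.1 hle)))
    have := hmono _ _ (h1.trans_lt h4)
    have := hmono _ _ (h3.trans_lt h2)
    omega
  set U := ⋃ n, T n with hU
  have hUm : MeasurableSet U := MeasurableSet.iUnion hTm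
  have hUsub : U ⊆ Set.Ioi 0 := Set.iUnion_subset fun n => Set.inter_subset_left
  have hW : ∫⁻ y, ((‖y‖₊ : ℝ≥0∞) ^ lam * f y) ^ p ≠ ⊤ := by
    intro hW
    apply hfin
    rw [wnorm, hW, ENNReal.top_rpow_of_pos (by positivity)]
  have hrest : ∫⁻ t in Set.Ioi 0 \ U, D t = 0 := by
    have hlt := ae_lt_top (μ := volume.restrict (Set.Ioi (0 : ℝ)))
      (f := fun t => ENNReal.ofReal t ^ (p - 1) * D t ^ (1 + lam * p / k)) (by fun_prop)
      ((hdist f hf).trans_lt (ENNReal.mul_lt_top hc₁.lt_top hW.lt_top)).ne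
    rw [lintegral_eq_zero_iff hD]
    have hlt' := ae_mono (Measure.restrict_mono_set volume
      (Set.sdiff_subset : Set.Ioi (0 : ℝ) \ U ⊆ Set.Ioi 0)) hlt
    filter_upwards [hlt', ae_restrict_mem (measurableSet_Ioi.diff hUm)] with t ht htU
    have htpos : 0 < t := htU.1
    have hDt : D t ≠ ⊤ := by
      intro htop
      rw [htop, ENNReal.top_rpow_of_pos (by positivity), ENNReal.mul_top] at ht
      · exact lt_irrefl _ ht
      · simp only [ne_eq, ENNReal.rpow_eq_zero_iff, ENNReal.ofReal_eq_zero, not_or, not_and_or]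
        exact ⟨Or.inl (not_le.2 htpos), Or.inl (by simp)⟩
    by_contra h0
    obtain ⟨n, hn⟩ := ENNReal.exists_mem_Ico_zpow h0 hDt one_lt_two (by simp)
    exact htU.2 (Set.mem_iUnion.2 ⟨n, htpos, hn⟩)
  refine ⟨fun n y => ∫⁻ t in T n, I t y, fun n => volume (T n), fun n => hmeas _, ?_, ?_, ?_, ?_⟩
  · have hzero : ∀ᵐ y, ∫⁻ t in Set.Ioi 0 \ U, I t y = 0 := by
      rw [← hswap, lintegral_eq_zero_iff (hmeas _)] at hrest
      exact hrest
    filter_upwards [hzero] with y hy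
    rw [← lintegral_iUnion hTm hTdisj]
    conv_lhs => rw [← lintegral_Ioi_ite_ofReal_lt (f y), ← Set.union_sdiff_cancel hUsub]
    refine (lintegral_union_le _ _ _).trans ?_
    change _ + ∫⁻ t in Set.Ioi 0 \ U, I t y ≤ _
    rw [hy, add_zero]
  · intro n y
    calc ∫⁻ t in T n, I t y ≤ ∫⁻ _ in T n, 1 := by
          refine lintegral_mono fun t => ?_
          simp only [hIdef]
          split_ifs <;> simp
      _ = volume (T n) := by simp
  · intro n
    rw [hswap, ← setLIntegral_const]
    refine setLIntegral_mono' (hTm n) fun t ht => ?_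
    rw [show ((n : ℝ) + 1) = ((n + 1 : ℤ) : ℝ) by push_cast; rfl, ENNReal.rpow_intCast]
    exact ht.2.2.le
  · have hsum : ∑' n : ℤ, (2 ^ ((n : ℝ) * (1 / p + lam / k)) * volume (T n)) ^ p ≤
        c₂ * c₁ * ∫⁻ y, ((‖y‖₊ : ℝ≥0∞) ^ lam * f y) ^ p := by
      calc ∑' n : ℤ, (2 ^ ((n : ℝ) * (1 / p + lam / k)) * volume (T n)) ^ p
          ≤ ∑' n : ℤ, c₂ * ∫⁻ t in T n, ENNReal.ofReal t ^ (p - 1) *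
              D t ^ (1 + lam * p / k) := by
            refine ENNReal.tsum_le_tsum fun n => ?_
            rw [ENNReal.mul_rpow_of_nonneg _ _ hp0.le, ← ENNReal.rpow_mul,
              show (n : ℝ) * (1 / p + lam / k) * p = n * (1 + lam * p / k) by field_simp,
              ENNReal.rpow_mul, ENNReal.rpow_intCast]
            refine (mul_le_mul_right (hline _ (hTm n)) _).trans ?_
            rw [mul_left_comm, ← lintegral_const_mul _ (by fun_prop)]
            refine mul_le_mul_right ?_ _
            refine setLIntegral_mono' (hTm n) fun t ht => ?_
            have htpos : 0 < t := ht.1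
            rw [mul_comm, Real.enorm_eq_ofReal htpos.le]
            gcongr
            exact ht.2.1
        _ = c₂ * ∫⁻ t in U, ENNReal.ofReal t ^ (p - 1) * D t ^ (1 + lam * p / k) := by
            rw [ENNReal.tsum_mul_left, lintegral_iUnion hTm hTdisj]
        _ ≤ c₂ * (c₁ * ∫⁻ y, ((‖y‖₊ : ℝ≥0∞) ^ lam * f y) ^ p) := by
            gcongr
            exact (lintegral_mono_set hUsub).trans (hdist f hf)
        _ = _ := by rw [mul_assoc]
    calc _ ≤ (c₂ * c₁ * ∫⁻ y, ((‖y‖₊ : ℝ≥0∞) ^ lam * f y) ^ p) ^ (1 / p) := by gcongr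
      _ = _ := by rw [ENNReal.mul_rpow_of_nonneg _ _ (by positivity), wnorm]

theorem ENNReal.prod_two_rpow {ι : Type*} (s : Finset ι) (x : ι → ℝ) :
    ∏ j ∈ s, (2 : ℝ≥0∞) ^ x j = 2 ^ ∑ j ∈ s, x j := by
  induction s using Finset.induction_on with
  | empty => simp
  | insert a s ha ih =>
    rw [Finset.prod_insert ha, Finset.sum_insert ha, ih,
      ENNReal.rpow_add _ _ (by simp) (by simp)]

theorem ENNReal.tsum_int_two_rpow_neg_ne_top {ε : ℝ} (hε : 0 < ε) :
    ∑' l : ℤ, (2 : ℝ≥0∞) ^ (-(ε * |(l : ℝ)|)) ≠ ⊤ := by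
  have hr0 : (0 : ℝ) ≤ 2 ^ (-ε) := by positivity
  have hr1 : (2 : ℝ) ^ (-ε) < 1 := Real.rpow_lt_one_of_one_lt_of_neg _root_.one_lt_two (by linarith)
  have hsum : Summable fun l : ℤ => ((2 : ℝ) ^ (-ε)) ^ l.natAbs :=
    Summable.of_nat_of_neg (by simpa using summable_geometric_of_lt_one hr0 hr1)
      (by simpa using summable_geometric_of_lt_one hr0 hr1)
  convert hsum.tsum_ofReal_ne_top using 3 with l
  have hl : |(l : ℝ)| = (l.natAbs : ℝ) := by rw [Nat.cast_natAbs, Int.cast_abs]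
  rw [← Real.rpow_natCast, ← Real.rpow_mul two_pos.le, ← ENNReal.ofReal_rpow_of_pos two_pos,
    ENNReal.ofReal_ofNat, hl, neg_mul]

/-- A family of integers can be split at a threshold into its `m` smallest members and the rest. -/
theorem exists_card_eq_and_threshold {N m : ℕ} (hm : 0 < m) (hmN : m ≤ N) (n : Fin N → ℤ) :
    ∃ (S : Finset (Fin N)) (τ : ℤ), S.card = m ∧ (∀ j ∈ S, n j ≤ τ) ∧ ∀ j ∉ S, τ ≤ n j := by
  have hne : (Finset.powersetCard m (Finset.univ : Finset (Fin N))).Nonempty :=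
    Finset.powersetCard_nonempty.2 (by simpa using hmN)
  obtain ⟨S, hS, hmin⟩ := Finset.exists_min_image _ (fun S => ∑ j ∈ S, n j) hne
  have hcard := (Finset.mem_powersetCard.1 hS).2
  have hSne : S.Nonempty := Finset.card_pos.1 (by omega)
  obtain ⟨i, hi, hmax⟩ := Finset.exists_max_image S n hSne
  refine ⟨S, n i, hcard, hmax, fun j hj => ?_⟩
  have hj' : j ∉ S.erase i := fun h => hj (Finset.mem_of_mem_erase h)
  have hswap := hmin (insert j (S.erase i)) (Finset.mem_powersetCard.2 ⟨Finset.subset_univ _, by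
    rw [Finset.card_insert_of_notMem hj', Finset.card_erase_of_mem hi]; omega⟩)
  rw [Finset.sum_insert hj', ← Finset.add_sum_erase S n hi] at hswap
  linarith

/-- In the interior of the hypersimplex, the indicator of the `m` smallest members of a family of
integers beats the exponent `a` by a multiple of the distances to the threshold. -/
theorem sum_add_one_le_of_threshold {N m : ℕ} {a : Fin N → ℝ} {ε : ℝ} (ha : ∀ j, ε ≤ a j)
    (ha' : ∀ j, ε ≤ 1 - a j) (hsum : ∑ j, a j = m) {n : Fin N → ℤ} {S : Finset (Fin N)} {τ : ℤ}
    (hcard : S.card = m) (hle : ∀ j ∈ S, n j ≤ τ) (hge : ∀ j ∉ S, τ ≤ n j) :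
    ∑ j ∈ S, ((n j : ℝ) + 1) ≤
      m + ∑ j, ((n j : ℝ) * a j + -(ε * |((n j - τ : ℤ) : ℝ)|)) := by
  have hterm : ∀ j, (if j ∈ S then (n j : ℝ) - τ else 0) ≤
      ((n j : ℝ) - τ) * a j + -(ε * |((n j - τ : ℤ) : ℝ)|) := by
    intro j
    push_cast
    split_ifs with h
    · have : (n j : ℝ) ≤ τ := by exact_mod_cast hle j h
      rw [abs_of_nonpos (by linarith)]
      nlinarith [ha' j]
    · have : (τ : ℝ) ≤ n j := by exact_mod_cast hge j h
      rw [abs_of_nonneg (by linarith)]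
      nlinarith [ha j]
  have htotal := Finset.sum_le_sum fun j (_ : j ∈ Finset.univ) => hterm j
  simp only [Finset.sum_ite_mem, Finset.univ_inter, sub_mul, Finset.sum_add_distrib,
    Finset.sum_sub_distrib, ← Finset.mul_sum, hsum, Finset.sum_const, hcard, nsmul_eq_mul]
    at htotal ⊢
  linarith

/-- `dotv` as a linear map in its second argument. -/
noncomputable def dotvLinear {m : ℕ} (k : ℕ) (v : Fin m → ℝ) :
    (Fin m → EuclideanSpace ℝ (Fin k)) →ₗ[ℝ] EuclideanSpace ℝ (Fin k) :=
  ∑ i, v i • LinearMap.proj i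

theorem dotvLinear_apply {m k : ℕ} (v : Fin m → ℝ) (x : Fin m → EuclideanSpace ℝ (Fin k)) :
    dotvLinear k v x = dotv v x := by
  simp [dotvLinear, dotv]

theorem measurable_dotv {m k : ℕ} (v : Fin m → ℝ) :
    Measurable (dotv v : (Fin m → EuclideanSpace ℝ (Fin k)) → EuclideanSpace ℝ (Fin k)) := by
  unfold dotv
  fun_prop

theorem ae_dotv_mem {m k : ℕ} {v : Fin m → ℝ} (hv : v ≠ 0)
    {s : Set (EuclideanSpace ℝ (Fin k))} (hs : MeasurableSet s) (h : ∀ᵐ y, y ∈ s) :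
    ∀ᵐ x : Fin m → EuclideanSpace ℝ (Fin k), dotv v x ∈ s := by
  have hsurj : Function.Surjective (dotvLinear k v) := by
    obtain ⟨i, hi⟩ := Function.ne_iff.1 hv
    intro y
    refine ⟨Pi.single i ((v i)⁻¹ • y), ?_⟩
    rw [dotvLinear_apply, dotv, Finset.sum_eq_single i]
    · rw [Pi.single_eq_same, smul_inv_smul₀ hi]
    · intro j _ hj
      simp [hj]
    · simp
  have := (ae_comp_linearMap_mem_iff (dotvLinear k v) volume volume hsurj hs).2 h
  simpa only [dotvLinear_apply] using this

/-- The Brascamp–Lieb form attached to a basis is a multiple of the product of the integrals. -/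
theorem exists_lintegral_prod_dotv_le {m k N : ℕ} {v : Fin N → Fin m → ℝ}
    {S : Finset (Fin N)} (hcard : S.card = m) (hspan : Submodule.span ℝ (v '' ↑S) = ⊤) :
    ∃ c : ℝ≥0∞, c ≠ ⊤ ∧ ∀ g : Fin N → EuclideanSpace ℝ (Fin k) → ℝ≥0∞,
      (∀ j, Measurable (g j)) →
      ∫⁻ x : Fin m → EuclideanSpace ℝ (Fin k), ∏ j ∈ S, g j (dotv (v j) x) ≤
        c * ∏ j ∈ S, ∫⁻ y, g j y := by
  set e := S.orderEmbOfFin hcard with he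
  have hprod : ∀ q : Fin N → ℝ≥0∞, ∏ j ∈ S, q j = ∏ i, q (e i) := by
    intro q
    conv_lhs => rw [← Finset.map_orderEmbOfFin_univ S hcard]
    rw [Finset.prod_map]
    rfl
  set L : (Fin m → EuclideanSpace ℝ (Fin k)) →ₗ[ℝ] (Fin m → EuclideanSpace ℝ (Fin k)) :=
    LinearMap.pi fun i => dotvLinear k (v (e i)) with hL
  have hLapp : ∀ x i, L x i = dotv (v (e i)) x := fun x i => by simp [hL, dotvLinear_apply]
  have hker : LinearMap.ker L = ⊥ := by
    rw [LinearMap.ker_eq_bot']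
    intro x hx
    let K : (Fin m → ℝ) →ₗ[ℝ] EuclideanSpace ℝ (Fin k) := Fintype.linearCombination ℝ x
    have hK : ∀ w, K w = dotv w x := fun w => by
      simp [K, Fintype.linearCombination_apply, dotv]
    have htop : (⊤ : Submodule ℝ (Fin m → ℝ)) ≤ LinearMap.ker K := by
      rw [← hspan, Submodule.span_le]
      rintro _ ⟨j, hj, rfl⟩
      obtain ⟨i, rfl⟩ : j ∈ Set.range e := by rwa [he, Finset.range_orderEmbOfFin]
      rw [SetLike.mem_coe, LinearMap.mem_ker, hK, ← hLapp, hx, Pi.zero_apply]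
    funext i
    have hi : K (Pi.single i 1) = 0 := htop Submodule.mem_top
    simpa [K, Fintype.linearCombination_apply_single] using hi
  have hdet : LinearMap.det L ≠ 0 :=
    (((LinearMap.isUnit_iff_ker_eq_bot L).2 hker).map LinearMap.det).ne_zero
  have hmap := Measure.map_linearMap_addHaar_eq_smul_addHaar
    (volume : Measure (Fin m → EuclideanSpace ℝ (Fin k))) hdet
  refine ⟨ENNReal.ofReal |(LinearMap.det L)⁻¹|, ENNReal.ofReal_ne_top, fun g hg => le_of_eq ?_⟩
  have hmeas : Measurable fun z : Fin m → EuclideanSpace ℝ (Fin k) => ∏ i, g (e i) (z i) :=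
    Finset.measurable_fun_prod _ fun i _ => (hg _).comp (measurable_pi_apply i)
  have hLm : Measurable L := L.continuous_of_finiteDimensional.measurable
  calc ∫⁻ x : Fin m → EuclideanSpace ℝ (Fin k), ∏ j ∈ S, g j (dotv (v j) x)
      = ∫⁻ x, ∏ i, g (e i) (L x i) := by simp_rw [hprod, hLapp]
    _ = ∫⁻ z, ∏ i, g (e i) (z i) ∂(volume.map L) := (lintegral_map hmeas hLm).symm
    _ = _ := by
      rw [hmap, lintegral_smul_measure, smul_eq_mul, hprod,
        lintegral_pi_prod_eq_prod (fun i => g (e i)) fun i => hg _]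

/-- Bound for the Brascamp–Lieb form at the vertices of the hypersimplex, uniform in the vertex. -/
theorem IsGeneric.exists_BLform_le {m k N : ℕ} {v : Fin N → Fin m → ℝ} (hgen : IsGeneric v) :
    ∃ c : ℝ≥0∞, c ≠ ⊤ ∧ ∀ (S : Finset (Fin N)), S.card = m →
      ∀ (g : Fin N → EuclideanSpace ℝ (Fin k) → ℝ≥0∞) (h w : Fin N → ℝ≥0∞),
      (∀ j, Measurable (g j)) → (∀ j y, g j y ≤ h j) → (∀ j, ∫⁻ y, g j y ≤ w j * h j) →
      BLform v g ≤ c * ((∏ j ∈ S, w j) * ∏ j, h j) := by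
  have hS : ∀ S : Finset (Fin N), ∃ c : ℝ≥0∞, c ≠ ⊤ ∧ (S.card = m →
      ∀ g : Fin N → EuclideanSpace ℝ (Fin k) → ℝ≥0∞, (∀ j, Measurable (g j)) →
      ∫⁻ x : Fin m → EuclideanSpace ℝ (Fin k), ∏ j ∈ S, g j (dotv (v j) x) ≤
        c * ∏ j ∈ S, ∫⁻ y, g j y) := by
    intro S
    by_cases hcard : S.card = m
    · obtain ⟨c, hc, h⟩ := exists_lintegral_prod_dotv_le (k := k) hcard (hgen S hcard).2
      exact ⟨c, hc, fun _ => h⟩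
    · exact ⟨0, by simp, fun h => absurd h hcard⟩
  choose c hc hbound using hS
  refine ⟨∑ S, c S, ENNReal.sum_ne_top.2 fun S _ => hc S, fun S hcard g h w hg hgh hgw => ?_⟩
  have hmeas : Measurable fun x : Fin m → EuclideanSpace ℝ (Fin k) =>
      ∏ j ∈ S, g j (dotv (v j) x) :=
    Finset.measurable_fun_prod _ fun j _ => (hg j).comp (measurable_dotv _)
  calc BLform v g
      ≤ ∫⁻ x : Fin m → EuclideanSpace ℝ (Fin k),
          (∏ j ∈ S, g j (dotv (v j) x)) * ∏ j ∈ Sᶜ, h j := by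
        refine lintegral_mono fun x => ?_
        rw [← Finset.prod_mul_prod_compl S]
        exact mul_le_mul_right (Finset.prod_le_prod' fun j _ => hgh j _) _
    _ = (∫⁻ x : Fin m → EuclideanSpace ℝ (Fin k), ∏ j ∈ S, g j (dotv (v j) x)) *
          ∏ j ∈ Sᶜ, h j := lintegral_mul_const _ hmeas
    _ ≤ (c S * ∏ j ∈ S, (w j * h j)) * ∏ j ∈ Sᶜ, h j := by
        gcongr
        refine (hbound S hcard g hg).trans ?_
        gcongr with j
        exact hgw j
    _ = c S * ((∏ j ∈ S, w j) * ∏ j, h j) := by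
        rw [Finset.prod_mul_distrib, ← Finset.prod_mul_prod_compl S h]
        ring
    _ ≤ _ := by
        gcongr
        exact Finset.single_le_sum (f := c) (fun _ _ => zero_le) (Finset.mem_univ S)

theorem BLform_mono_ae {m k N : ℕ} {v : Fin N → Fin m → ℝ} (hv0 : ∀ j, v j ≠ 0)
    {f g : Fin N → EuclideanSpace ℝ (Fin k) → ℝ≥0∞} (hf : ∀ j, Measurable (f j))
    (hg : ∀ j, Measurable (g j)) (hfg : ∀ j, ∀ᵐ y, f j y ≤ g j y) :
    BLform v f ≤ BLform v g := by
  refine lintegral_mono_ae ?_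
  have hae : ∀ j, ∀ᵐ x : Fin m → EuclideanSpace ℝ (Fin k),
      f j (dotv (v j) x) ≤ g j (dotv (v j) x) := fun j =>
    ae_dotv_mem (s := {y | f j y ≤ g j y}) (hv0 j) (measurableSet_le (hf j) (hg j)) (hfg j)
  filter_upwards [ae_all_iff.2 hae] with x hx
  exact Finset.prod_le_prod' fun j _ => hx j

theorem BLform_tsum {m k N : ℕ} (v : Fin N → Fin m → ℝ)
    {F : Fin N → ℤ → EuclideanSpace ℝ (Fin k) → ℝ≥0∞} (hF : ∀ j n, Measurable (F j n)) :
    BLform v (fun j y => ∑' n, F j n y) =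
      ∑' n : Fin N → ℤ, BLform v (fun j => F j (n j)) := by
  unfold BLform
  simp_rw [ENNReal.prod_tsum_eq_tsum_prod]
  refine lintegral_tsum fun n => Measurable.aemeasurable ?_
  exact Finset.measurable_fun_prod _ fun j _ => (hF j _).comp (measurable_dotv _)

theorem ae_eq_zero_of_wnorm_eq_zero {k : ℕ} (hk : 0 < k) {p lam : ℝ} (hp : 0 < p)
    {f : EuclideanSpace ℝ (Fin k) → ℝ≥0∞} (hf : Measurable f)
    (h : wnorm p lam f = 0) : ∀ᵐ y, f y = 0 := by
  have : Nonempty (Fin k) := ⟨⟨0, hk⟩⟩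
  rw [wnorm, ENNReal.rpow_eq_zero_iff_of_pos (by positivity),
    lintegral_eq_zero_iff (by fun_prop)] at h
  filter_upwards [h, Measure.ae_ne volume (0 : EuclideanSpace ℝ (Fin k))] with y hy hy0
  rw [Pi.zero_apply, ENNReal.rpow_eq_zero_iff_of_pos hp, mul_eq_zero] at hy
  refine hy.resolve_left ?_
  simp [ENNReal.rpow_eq_zero_iff, hy0]

/-- The estimate in the interior of the hypersimplex, for functions with finite norms. -/
theorem exists_BLform_le_of_interior {m k N : ℕ} (hm : 0 < m) (hk : 0 < k)
    {v : Fin N → Fin m → ℝ} (hv0 : ∀ j, v j ≠ 0) (hgen : IsGeneric v)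
    {p lam : Fin N → ℝ} (hp : ∀ j, 1 < p j) (hlam : ∀ j, 0 ≤ lam j)
    (hScaling : ∑ j, (1 / p j + lam j / (k : ℝ)) = (m : ℝ))
    (hlt : ∀ j, 1 / p j + lam j / (k : ℝ) < 1) (hI : 1 ≤ ∑ j, 1 / p j) :
    ∃ C : ℝ≥0∞, C ≠ ⊤ ∧
      ∀ f : Fin N → EuclideanSpace ℝ (Fin k) → ℝ≥0∞, (∀ j, Measurable (f j)) →
        (∀ j, wnorm (p j) (lam j) (f j) ≠ ⊤) →
        BLform v f ≤ C * ∏ j, wnorm (p j) (lam j) (f j) := by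
  set a : Fin N → ℝ := fun j => 1 / p j + lam j / (k : ℝ) with ha
  have hp0 : ∀ j, 0 < p j := fun j => zero_lt_one.trans (hp j)
  have ha0 : ∀ j, 0 < a j := fun j => by
    have := hp0 j
    have := hlam j
    positivity
  have hmN : m ≤ N := by
    have : (m : ℝ) ≤ N := by
      rw [← hScaling]
      refine (Finset.sum_le_sum fun j _ => (hlt j).le).trans ?_
      simp
    exact_mod_cast this
  obtain ⟨ε, hε, hεa, hεa'⟩ : ∃ ε : ℝ, 0 < ε ∧ (∀ j, ε ≤ a j) ∧ ∀ j, ε ≤ 1 - a j := by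
    have : Nonempty (Fin N) := ⟨⟨0, by omega⟩⟩
    obtain ⟨i, hi⟩ := Finite.exists_min fun j => min (a j) (1 - a j)
    exact ⟨min (a i) (1 - a i), lt_min (ha0 i) (sub_pos.2 (hlt i)),
      fun j => (hi j).trans (min_le_left _ _), fun j => (hi j).trans (min_le_right _ _)⟩
  choose c hc hdecomp using fun j => exists_atomic_decomposition hk (hp j) (hlam j)
  obtain ⟨c₀, hc₀, hvertex⟩ := hgen.exists_BLform_le (k := k)
  set φ : ℤ → ℝ≥0∞ := fun l => 2 ^ (-(ε * |(l : ℝ)|)) with hφ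
  have hφtop : ∑' l, φ l ≠ ⊤ := ENNReal.tsum_int_two_rpow_neg_ne_top hε
  refine ⟨c₀ * 2 ^ (m : ℝ) * ∏ j, ((∑' l, φ l) * c j), ?_, fun f hf hfin => ?_⟩
  · refine ENNReal.mul_ne_top (ENNReal.mul_ne_top hc₀ (by simp)) ?_
    exact ENNReal.prod_ne_top fun j _ => ENNReal.mul_ne_top hφtop (hc j)
  choose F h hFm hfF hFh hFint hsum using fun j => hdecomp j (f j) (hf j) (hfin j)
  set b : Fin N → ℤ → ℝ≥0∞ := fun j n => 2 ^ ((n : ℝ) * a j) * h j n with hb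
  have hpiece : ∀ n : Fin N → ℤ, BLform v (fun j => F j (n j)) ≤
      c₀ * 2 ^ (m : ℝ) * ∑' τ : ℤ, ∏ j, (b j (n j) * φ (n j - τ)) := by
    intro n
    obtain ⟨S, τ, hcard, hle, hge⟩ := exists_card_eq_and_threshold hm hmN n
    have hexp := sum_add_one_le_of_threshold hεa hεa' hScaling hcard hle hge
    calc BLform v (fun j => F j (n j))
        ≤ c₀ * ((∏ j ∈ S, (2 : ℝ≥0∞) ^ ((n j : ℝ) + 1)) * ∏ j, h j (n j)) :=
          hvertex S hcard _ (fun j => h j (n j)) _ (fun j => hFm j _) (fun j => hFh j _)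
            fun j => hFint j _
      _ ≤ c₀ * ((2 ^ (m : ℝ) * ∏ j, ((2 : ℝ≥0∞) ^ ((n j : ℝ) * a j) * φ (n j - τ))) *
            ∏ j, h j (n j)) := by
          gcongr
          simp_rw [hφ, ← ENNReal.rpow_add _ _ (two_ne_zero : (2 : ℝ≥0∞) ≠ 0) ENNReal.ofNat_ne_top]
          rw [ENNReal.prod_two_rpow, ENNReal.prod_two_rpow,
            ← ENNReal.rpow_add _ _ (by simp) (by simp)]
          exact ENNReal.rpow_le_rpow_of_exponent_le one_le_two hexp
      _ = c₀ * 2 ^ (m : ℝ) * ∏ j, (b j (n j) * φ (n j - τ)) := by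
          simp only [hb, Finset.prod_mul_distrib]
          ring
      _ ≤ _ := by
          gcongr
          exact ENNReal.le_tsum (f := fun τ : ℤ => ∏ j, (b j (n j) * φ (n j - τ))) τ
  calc BLform v f ≤ BLform v (fun j y => ∑' n, F j n y) :=
        BLform_mono_ae hv0 hf (fun j => Measurable.tsum fun n => hFm j n) hfF
    _ = ∑' n : Fin N → ℤ, BLform v (fun j => F j (n j)) := BLform_tsum v hFm
    _ ≤ ∑' n : Fin N → ℤ, c₀ * 2 ^ (m : ℝ) * ∑' τ : ℤ, ∏ j, (b j (n j) * φ (n j - τ)) :=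
        ENNReal.tsum_le_tsum hpiece
    _ = c₀ * 2 ^ (m : ℝ) * ∑' τ : ℤ, ∏ j, ∑' n, b j n * φ (n - τ) := by
        rw [ENNReal.tsum_mul_left, ENNReal.tsum_comm]
        simp_rw [ENNReal.prod_tsum_eq_tsum_prod]
    _ ≤ c₀ * 2 ^ (m : ℝ) * ∏ j, (((∑' l, φ l) * c j) * wnorm (p j) (lam j) (f j)) := by
        gcongr
        refine (ENNReal.tsum_prod_le_prod_Lp hp0 hI _).trans ?_
        refine Finset.prod_le_prod' fun j _ => ?_
        refine (ENNReal.tsum_convolution_rpow_le (hp j).le (b j) φ).trans ?_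
        rw [mul_assoc]
        exact mul_le_mul_right (hsum j) _
    _ = _ := by rw [Finset.prod_mul_distrib, ← mul_assoc]

/-- The subspace conditions force each exponent `a j` to be smaller than one. -/
theorem lt_one_of_subspace_condition {m N : ℕ} (hm : 0 < m) {v : Fin N → Fin m → ℝ}
    (hv0 : ∀ j, v j ≠ 0) {a r : Fin N → ℝ} (hr0 : ∀ j, 0 < r j) (hr1 : ∀ j, r j < 1)
    (hra : ∀ j, r j ≤ a j) (hsum : ∑ j, a j = m) (hr : 1 ≤ ∑ j, r j)
    (hv1 : ∀ V : Submodule ℝ (Fin m → ℝ), V ≠ ⊥ → V ≠ ⊤ →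
      (m : ℝ) - (Module.finrank ℝ V : ℝ) < ∑ j ∈ Finset.univ.filter (fun j => v j ∉ V), a j)
    (j : Fin N) : a j < 1 := by
  have ha0 : ∀ i, 0 < a i := fun i => (hr0 i).trans_le (hra i)
  rcases (show 1 ≤ m from hm).eq_or_lt with rfl | hm2
  · obtain ⟨i, hij⟩ : ∃ i, i ≠ j := by
      by_contra! hall
      have : ∑ i, r i = r j := by
        rw [Finset.sum_eq_single j (fun i _ hi => absurd (hall i) hi) (by simp)]
      linarith [hr1 j]
    have := Finset.add_le_sum (f := a) (fun i _ => (ha0 i).le) (Finset.mem_univ i)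
      (Finset.mem_univ j) hij
    rw [hsum] at this
    push_cast at this
    linarith [ha0 i]
  · have hrank : Module.finrank ℝ (Submodule.span ℝ {v j}) = 1 := finrank_span_singleton (hv0 j)
    have hV := hv1 (Submodule.span ℝ {v j}) (by simpa using hv0 j) (by
      intro htop
      rw [htop, finrank_top, Module.finrank_fin_fun] at hrank
      omega)
    rw [hrank] at hV
    have hle : ∑ i ∈ Finset.univ.filter (fun i => v i ∉ Submodule.span ℝ {v j}), a i ≤
        ∑ i ∈ Finset.univ.erase j, a i := by
      refine Finset.sum_le_sum_of_subset_of_nonneg ?_ fun i _ _ => (ha0 i).le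
      intro i hi
      refine Finset.mem_erase.2 ⟨?_, Finset.mem_univ i⟩
      rintro rfl
      exact (Finset.mem_filter.1 hi).2 (Submodule.mem_span_singleton_self _)
    have := Finset.add_sum_erase Finset.univ a (Finset.mem_univ j)
    push_cast at hV
    linarith

/-- Sufficiency in the case of nonnegative weight exponents: for a generic set of
vectors, (Scaling), (v1) and (I) with `λ_j ≥ 0` imply the weighted estimate. -/
theorem suffthm_nonneg (m k N : ℕ) (hm : 0 < m) (hk : 0 < k) (hN : 0 < N)
    (v : Fin N → Fin m → ℝ) (hv0 : ∀ j, v j ≠ 0) (hvinj : Function.Injective v)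
    (hgen : IsGeneric v)
    (p lam : Fin N → ℝ)
    (hp : ∀ j, 0 < 1 / p j ∧ 1 / p j < 1)
    (hlam : ∀ j, 0 ≤ lam j)
    (hScaling : ∑ j, (1 / p j + lam j / (k : ℝ)) = (m : ℝ))
    (hv1 : ∀ V : Submodule ℝ (Fin m → ℝ), V ≠ ⊥ → V ≠ ⊤ →
      (m : ℝ) - (Module.finrank ℝ V : ℝ) <
        ∑ j ∈ Finset.univ.filter (fun j => v j ∉ V), (1 / p j + lam j / (k : ℝ)))
    (hI : 1 ≤ ∑ j, 1 / p j) :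
    ∃ C : ℝ≥0∞, C ≠ ⊤ ∧
      ∀ f : Fin N → EuclideanSpace ℝ (Fin k) → ℝ≥0∞, (∀ j, Measurable (f j)) →
        BLform v f ≤ C * ∏ j, wnorm (p j) (lam j) (f j) := by
  have hp0 : ∀ j, 0 < p j := fun j => one_div_pos.1 (hp j).1
  have hp1 : ∀ j, 1 < p j := fun j => (div_lt_one (hp0 j)).1 (hp j).2
  have hlt := lt_one_of_subspace_condition hm hv0 (fun j => (hp j).1) (fun j => (hp j).2)
    (fun j => le_add_of_nonneg_right (div_nonneg (hlam j) k.cast_nonneg)) hScaling hI hv1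
  obtain ⟨C, hC, hbound⟩ :=
    exists_BLform_le_of_interior hm hk hv0 hgen hp1 hlam hScaling hlt hI
  refine ⟨C + 1, by simp [hC], fun f hf => ?_⟩
  by_cases hfin : ∀ j, wnorm (p j) (lam j) (f j) ≠ ⊤
  · exact (hbound f hf hfin).trans (by gcongr; exact le_self_add)
  · push Not at hfin
    obtain ⟨i, hi⟩ := hfin
    by_cases hzero : ∃ j, wnorm (p j) (lam j) (f j) = 0
    · obtain ⟨j, hj⟩ := hzero
      have hae := ae_dotv_mem (hv0 j) (hf j (measurableSet_singleton 0))
        (ae_eq_zero_of_wnorm_eq_zero hk (hp0 j) (hf j) hj)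
      have hBL : BLform v f = 0 := by
        rw [BLform, ← lintegral_zero]
        refine lintegral_congr_ae ?_
        filter_upwards [hae] with x hx
        exact Finset.prod_eq_zero (Finset.mem_univ j) hx
      rw [hBL]
      exact zero_le
    · push Not at hzero
      have htop : ∏ j, wnorm (p j) (lam j) (f j) = ⊤ := by
        rw [← Finset.mul_prod_erase _ _ (Finset.mem_univ i), hi]
        exact ENNReal.top_mul (Finset.prod_ne_zero_iff.2 fun j _ => hzero j)
      rw [htop, ENNReal.mul_top (by simp)]
      exact le_top
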